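/- arXiv:1201.3392 — 4 statements merged into one kernel-verified Lean document; each statement's English description precedes it below -/
import Mathlib

section
/- Let B be a commutative complex algebra which is an integral domain, let Γ be a group, and let α : B → B ⊗[ℂ] ℂ[Γ] be a homomorphism of complex algebras into the tensor product of B with the group algebra of Γ. Suppose (x_i)_{i∈ι} is a family of nonzero elements of B and (g_i)_{i∈ι} a family of elements of Γ such that α(x_i) = x_i ⊗ g_i for every i. Then g_i g_j = g_j g_i for all i, j; consequently the subgroup of Γ generated by {g_i : i ∈ ι} is commutative. -/
open scoped TensorProduct

/-- If `B` is a commutative complex algebra which is an integral domain,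
`Γ` a group, and `α : B → B ⊗[ℂ] ℂ[Γ]` an algebra homomorphism such that a family of
nonzero elements `x i` of `B` satisfies `α (x i) = x i ⊗ g i` with `g i ∈ Γ`, then the
`g i` pairwise commute, and the subgroup they generate is commutative. -/
theorem group_dual_diagonal_coaction_on_domain_commutes
    {B : Type*} [CommRing B] [IsDomain B] [Algebra ℂ B]
    {Γ : Type*} [Group Γ] {ι : Type*}
    (α : B →ₐ[ℂ] B ⊗[ℂ] MonoidAlgebra ℂ Γ)
    (x : ι → B) (g : ι → Γ) (hx : ∀ i, x i ≠ 0)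
    (hα : ∀ i, α (x i) = x i ⊗ₜ[ℂ] (MonoidAlgebra.of ℂ Γ (g i))) :
    (∀ i j, g i * g j = g j * g i) ∧
      ∀ a ∈ Subgroup.closure (Set.range g), ∀ b ∈ Subgroup.closure (Set.range g),
        a * b = b * a := by
  have h1 : ∀ i j, g i * g j = g j * g i := by
    intro i j
    have h : α (x i) * α (x j) = α (x j) * α (x i) := by
      rw [← map_mul, ← map_mul, mul_comm]
    rw [hα, hα, Algebra.TensorProduct.tmul_mul_tmul, Algebra.TensorProduct.tmul_mul_tmul,
      mul_comm (x j) (x i), ← map_mul, ← map_mul, ← sub_eq_zero, ← TensorProduct.tmul_sub] at h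
    have hne : x i * x j ≠ 0 := mul_ne_zero (hx i) (hx j)
    obtain ⟨f, hf⟩ : ∃ f : Module.Dual ℂ B, f (x i * x j) ≠ 0 := by
      by_contra hcon
      push Not at hcon
      exact hne ((Module.forall_dual_apply_eq_zero_iff ℂ _).mp hcon)
    have h2 := congrArg (fun t => TensorProduct.lid ℂ _ (LinearMap.rTensor _ f t)) h
    simp only [LinearMap.rTensor_tmul, TensorProduct.lid_tmul, map_zero] at h2
    exact MonoidAlgebra.of_injective (sub_eq_zero.mp ((smul_eq_zero.mp h2).resolve_left hf))
  refine ⟨h1, fun a ha b hb => ?_⟩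
  refine Subgroup.closure_induction₂ (p := fun a b _ _ => a * b = b * a) ?_ ?_ ?_ ?_ ?_ ?_ ?_ ha hb
  · rintro _ _ ⟨i, rfl⟩ ⟨j, rfl⟩
    exact h1 i j
  · intros; simp
  · intros; simp
  · intro a b c _ _ _ h h'
    exact Commute.mul_left h h'
  · intro a b c _ _ _ h h'
    exact Commute.mul_right h h'
  · intro a b _ _ h
    exact Commute.inv_left h
  · intro a b _ _ h
    exact Commute.inv_right h
end

section
/- Let Γ be a group, g_1, …, g_n ∈ Γ, and let U be a unitary n×n complex matrix. Assume that for all indices j, s, t, if U_{js} ≠ 0 and U_{jt} ≠ 0 then g_s = g_t. Then for all i ≠ j one has ∑_{k=1}^n U_{ik} · conj(U_{jk}) · g_k = 0 in the group algebra ℂ[Γ]; that is, all off-diagonal entries of the matrix U · diag(g_1, …, g_n) · U* with entries in ℂ[Γ] vanish. -/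
/-- Let `Γ` be a group, `g 1, …, g n ∈ Γ`, and `U` a unitary `n × n`
complex matrix. If `g s = g t` whenever some row `j` of `U` satisfies `U j s ≠ 0` and
`U j t ≠ 0`, then all off-diagonal entries of `U · diag(g) · U*`, computed in the group
algebra `ℂ[Γ]`, vanish: `∑ k, U i k · conj (U j k) · g k = 0` for `i ≠ j`. -/
theorem offdiagonal_of_conjugated_diagonal_vanishes
    {Γ : Type*} [Group Γ] {n : ℕ} (g : Fin n → Γ)
    (U : Matrix (Fin n) (Fin n) ℂ) (hU : U ∈ Matrix.unitaryGroup (Fin n) ℂ)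
    (h : ∀ j s t, U j s ≠ 0 → U j t ≠ 0 → g s = g t) :
    ∀ i j, i ≠ j →
      ∑ k, (U i k * (starRingEnd ℂ) (U j k)) • MonoidAlgebra.of ℂ Γ (g k)
        = (0 : MonoidAlgebra ℂ Γ) := by
  intro i j hij
  have horth : ∑ k, U i k * (starRingEnd ℂ) (U j k) = 0 := by
    have h1 := congrFun (congrFun (Matrix.mem_unitaryGroup_iff.mp hU) i) j
    rw [Matrix.mul_apply, Matrix.one_apply_ne hij] at h1
    simpa [Matrix.star_apply] using h1
  by_cases hz : ∀ k, U i k = 0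
  · simp [hz]
  · push Not at hz
    obtain ⟨m, hm⟩ := hz
    have h2 : ∀ k, (U i k * (starRingEnd ℂ) (U j k)) • MonoidAlgebra.of ℂ Γ (g k)
        = (U i k * (starRingEnd ℂ) (U j k)) • MonoidAlgebra.of ℂ Γ (g m) := by
      intro k
      by_cases hk : U i k = 0
      · rw [hk, zero_mul, zero_smul, zero_smul]
      · rw [h i k m hk hm]
    rw [Finset.sum_congr rfl (fun k _ => h2 k), ← Finset.sum_smul, horth, zero_smul]
end

section
/- Let Γ be a group, g_1, …, g_n ∈ Γ, and let U be a unitary n×n complex matrix. Assume that for all i ≠ j one has ∑_{k=1}^n U_{ik} · conj(U_{jk}) · g_k = 0 in the group algebra ℂ[Γ] (all off-diagonal entries of U · diag(g_1, …, g_n) · U* vanish). Then for all indices j, s, t, if U_{js} ≠ 0 and U_{jt} ≠ 0 then g_s = g_t. -/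
/-- Let `Γ` be a group, `g 1, …, g n ∈ Γ`, and `U` a unitary `n × n`
complex matrix. If all off-diagonal entries of `U · diag(g) · U*`, computed in the group
algebra `ℂ[Γ]`, vanish, then `g s = g t` whenever some row `j` of `U` satisfies
`U j s ≠ 0` and `U j t ≠ 0`. -/
theorem rows_identify_generators_of_offdiagonal_vanishing
    {Γ : Type*} [Group Γ] {n : ℕ} (g : Fin n → Γ)
    (U : Matrix (Fin n) (Fin n) ℂ) (hU : U ∈ Matrix.unitaryGroup (Fin n) ℂ)
    (h : ∀ i j, i ≠ j →
      ∑ k, (U i k * (starRingEnd ℂ) (U j k)) • MonoidAlgebra.of ℂ Γ (g k)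
        = (0 : MonoidAlgebra ℂ Γ)) :
    ∀ j s t, U j s ≠ 0 → U j t ≠ 0 → g s = g t := by
  classical
  intro j s t hs ht
  set p : Fin n → ℂ := fun k => if g k = g s then 1 else 0 with hp
  have hoff : ∀ a b, a ≠ b → (U * Matrix.diagonal p * star U) a b = 0 := by
    intro a b hab
    have h1 := congrArg (fun f : MonoidAlgebra ℂ Γ => f.coeff (g s)) (h a b hab)
    simp [MonoidAlgebra.coeff_sum, Finsupp.finset_sum_apply, Finsupp.single_apply] at h1
    rw [Matrix.mul_apply, ← h1]
    refine Finset.sum_congr rfl fun k _ => ?_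
    rw [Matrix.mul_diagonal]
    by_cases hk : g k = g s <;> simp [hp, hk, Matrix.star_apply]
  have hD : (U * Matrix.diagonal p * star U) * U = U * Matrix.diagonal p := by
    rw [Matrix.mul_assoc, Matrix.mem_unitaryGroup_iff'.mp hU, Matrix.mul_one]
  have key : ∀ k, (U * Matrix.diagonal p * star U) j j * U j k = U j k * p k := by
    intro k
    have h2 := congrFun (congrFun hD j) k
    rw [Matrix.mul_diagonal, Matrix.mul_apply, Finset.sum_eq_single j] at h2
    · exact h2
    · intro b _ hb
      rw [hoff j b hb.symm, zero_mul]
    · simp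
  have e1 := key s
  have e2 := key t
  have ps : p s = 1 := by simp [hp]
  rw [ps, mul_comm] at e1
  rw [mul_left_cancel₀ hs e1, mul_comm] at e2
  have e3 := mul_left_cancel₀ ht e2
  by_contra hne
  have : p t = 0 := by simp [hp, Ne.symm hne]
  rw [this] at e3
  exact one_ne_zero e3
end

section
/- Let K be a field, V and W vector spaces over K, and f : V → V, g : W → W linear endomorphisms such that the eigenspaces of f span V (⨆_λ E_λ(f) = V) and the eigenspaces of g span W (⨆_μ E_μ(g) = W). Assume the spectra 'do not mix': for all scalars λ, λ' which are eigenvalues of f and μ, μ' which are eigenvalues of g, λ + μ = λ' + μ' implies λ = λ' and μ = μ'. Then for every eigenvalue λ of f and every eigenvalue μ of g, the eigenspace of the endomorphism f ⊗ 1 + 1 ⊗ g of V ⊗[K] W for the scalar λ + μ is exactly the image of E_λ(f) ⊗[K] E_μ(g) under the canonical map into V ⊗[K] W. -/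
open scoped TensorProduct

/-- Let `f : V → V` and `g : W → W` be endomorphisms of `K`-vector
spaces whose eigenspaces span `V` resp. `W`, and whose spectra do not mix:
`λ + μ = λ' + μ'` implies `λ = λ'` and `μ = μ'` for eigenvalues `λ, λ'` of `f` and
`μ, μ'` of `g`. Then for any eigenvalue `λ` of `f` and `μ` of `g`, the eigenspace of
`f ⊗ 1 + 1 ⊗ g` on `V ⊗[K] W` for `λ + μ` is exactly the image of
`E_λ(f) ⊗[K] E_μ(g)` under the canonical map. -/
theorem eigenspace_of_tensor_sum_of_nonmixing_spectra
    {K V W : Type*} [Field K] [AddCommGroup V] [Module K V]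
    [AddCommGroup W] [Module K W]
    (f : Module.End K V) (g : Module.End K W)
    (hf : (⨆ ν : K, f.eigenspace ν) = ⊤)
    (hg : (⨆ ν : K, g.eigenspace ν) = ⊤)
    (hmix : ∀ lam lam' mu mu' : K, f.HasEigenvalue lam → f.HasEigenvalue lam' →
      g.HasEigenvalue mu → g.HasEigenvalue mu' → lam + mu = lam' + mu' →
      lam = lam' ∧ mu = mu')
    (lam mu : K) (hlam : f.HasEigenvalue lam) (hmu : g.HasEigenvalue mu) :
    Module.End.eigenspace
        ((TensorProduct.map f LinearMap.id + TensorProduct.map LinearMap.id g :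
          TensorProduct K V W →ₗ[K] TensorProduct K V W)) (lam + mu)
      = LinearMap.range (TensorProduct.mapIncl (f.eigenspace lam) (g.eigenspace mu)) := by
  set T : Module.End K (TensorProduct K V W) :=
    TensorProduct.map f LinearMap.id + TensorProduct.map LinearMap.id g with hT
  have key : ∀ a b : K, ∀ v ∈ f.eigenspace a, ∀ w ∈ g.eigenspace b,
      v ⊗ₜ[K] w ∈ T.eigenspace (a + b) := by
    intro a b v hv w hw
    rw [Module.End.mem_eigenspace_iff] at hv hw ⊢
    simp [hT, hv, hw, add_smul, TensorProduct.smul_tmul']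
  set R := LinearMap.range (TensorProduct.mapIncl (f.eigenspace lam) (g.eigenspace mu)) with hR
  have hRE : R ≤ T.eigenspace (lam + mu) := by
    rintro _ ⟨x, rfl⟩
    induction x using TensorProduct.induction_on with
    | zero => simp
    | tmul v w => exact key lam mu v v.2 w w.2
    | add x y hx hy => rw [map_add]; exact Submodule.add_mem _ hx hy
  set S := ⨆ (ν : K) (_ : ν ≠ lam + mu), T.eigenspace ν with hS
  have hdis : Disjoint (T.eigenspace (lam + mu)) S :=
    (Module.End.eigenspaces_iSupIndep T) (lam + mu)
  have htop : R ⊔ S = ⊤ := by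
    rw [eq_top_iff]
    rintro x -
    induction x using TensorProduct.induction_on with
    | zero => exact Submodule.zero_mem _
    | add x y hx hy => exact Submodule.add_mem _ hx hy
    | tmul v w =>
      have hv : v ∈ ⨆ ν : K, f.eigenspace ν := hf ▸ Submodule.mem_top
      have hw : w ∈ ⨆ ν : K, g.eigenspace ν := hg ▸ Submodule.mem_top
      refine Submodule.iSup_induction _ (motive := fun v => v ⊗ₜ[K] w ∈ R ⊔ S) hv ?_ ?_ ?_
      · intro a v hv
        refine Submodule.iSup_induction _ (motive := fun w => v ⊗ₜ[K] w ∈ R ⊔ S) hw ?_ ?_ ?_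
        · intro b w hw
          by_cases hv0 : v = 0
          · simp [hv0]
          by_cases hw0 : w = 0
          · simp [hw0]
          by_cases hab : a + b = lam + mu
          · obtain ⟨rfl, rfl⟩ := hmix a lam b mu
              (Module.End.hasEigenvalue_of_hasEigenvector ⟨hv, hv0⟩) hlam
              (Module.End.hasEigenvalue_of_hasEigenvector ⟨hw, hw0⟩) hmu hab
            exact Submodule.mem_sup_left ⟨⟨v, hv⟩ ⊗ₜ[K] ⟨w, hw⟩, rfl⟩
          · exact Submodule.mem_sup_right
              (Submodule.mem_iSup_of_mem (a + b)
                (Submodule.mem_iSup_of_mem hab (key a b v hv w hw)))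
        · simp
        · intro w w' h h'
          rw [TensorProduct.tmul_add]; exact Submodule.add_mem _ h h'
      · simp
      · intro v v' h h'
        rw [TensorProduct.add_tmul]; exact Submodule.add_mem _ h h'
  refine le_antisymm ?_ hRE
  intro x hx
  have hx' : x ∈ R ⊔ S := htop ▸ Submodule.mem_top
  obtain ⟨r, hr, s, hs, rfl⟩ := Submodule.mem_sup.1 hx'
  have hsE : s ∈ T.eigenspace (lam + mu) := by
    simpa using Submodule.sub_mem _ hx (hRE hr)
  have : s = 0 := Submodule.disjoint_def.1 hdis s hsE hs
  simpa [this] using hr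
end
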